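/- Suppose h: B^d → R is a C^2 convex function whose mean curvature Mean(h)(x) = (1/d)L(x)(Δh(x) - Hess h(x)(x,x)) is bounded above on B^d. Then h extends continuously to the closed ball. -/

import Mathlib

/-- Euclidean Hessian of `h` at `x` evaluated on directions `X`, `Y`. -/
noncomputable def Hess {d : ℕ} (h : EuclideanSpace ℝ (Fin d) → ℝ)
    (x X Y : EuclideanSpace ℝ (Fin d)) : ℝ :=
  fderiv ℝ (fun y => fderiv ℝ h y X) x Y

/-- Euclidean Laplacian of `h` at `x` (trace of the Hessian). -/
noncomputable def lapl {d : ℕ} (h : EuclideanSpace ℝ (Fin d) → ℝ)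
    (x : EuclideanSpace ℝ (Fin d)) : ℝ :=
  ∑ i, Hess h x (EuclideanSpace.single i 1) (EuclideanSpace.single i 1)

/-- The mean curvature `Mean(h)(x) = (1/d) L(x) (Δh(x) - Hess h(x)(x,x))`. -/
noncomputable def Mean {d : ℕ} (h : EuclideanSpace ℝ (Fin d) → ℝ)
    (x : EuclideanSpace ℝ (Fin d)) : ℝ :=
  (1 / d) * Real.sqrt (1 - ‖x‖ ^ 2) * (lapl h x - Hess h x x x)

theorem hess_eq_fderiv_fderiv {d : ℕ} {h : EuclideanSpace ℝ (Fin d) → ℝ}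
    {x : EuclideanSpace ℝ (Fin d)} (hx : DifferentiableAt ℝ (fderiv ℝ h) x)
    (X Y : EuclideanSpace ℝ (Fin d)) : Hess h x X Y = fderiv ℝ (fderiv ℝ h) x Y X := by
  have := (hx.hasFDerivAt.clm_apply (hasFDerivAt_const X x)).fderiv
  simp [Hess, this]

theorem hasDerivAt_fderiv_line {d : ℕ} {h : EuclideanSpace ℝ (Fin d) → ℝ}
    {x v : EuclideanSpace ℝ (Fin d)} {t : ℝ} (hx : DifferentiableAt ℝ (fderiv ℝ h) (x + t • v)) :
    HasDerivAt (fun s : ℝ => fderiv ℝ h (x + s • v) v) (Hess h (x + t • v) v v) t := by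
  have h1 : HasDerivAt (fun s : ℝ => x + s • v) v t := by
    simpa using ((hasDerivAt_id t).smul_const v).const_add x
  have h2 : DifferentiableAt ℝ (fun y => fderiv ℝ h y v) (x + t • v) :=
    hx.clm_apply (differentiableAt_const v)
  exact h2.hasFDerivAt.comp_hasDerivAt t h1

theorem hasDerivAt_line {d : ℕ} {h : EuclideanSpace ℝ (Fin d) → ℝ}
    {x v : EuclideanSpace ℝ (Fin d)} {t : ℝ} (hx : DifferentiableAt ℝ h (x + t • v)) :
    HasDerivAt (fun s : ℝ => h (x + s • v)) (fderiv ℝ h (x + t • v) v) t := by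
  have h1 : HasDerivAt (fun s : ℝ => x + s • v) v t := by
    simpa using ((hasDerivAt_id t).smul_const v).const_add x
  exact hx.hasFDerivAt.comp_hasDerivAt t h1

/-- The Hessian of a convex function is positive semidefinite. -/
theorem hess_nonneg_of_convexOn {d : ℕ} {h : EuclideanSpace ℝ (Fin d) → ℝ}
    {U : Set (EuclideanSpace ℝ (Fin d))} (hU : IsOpen U) (hreg : ContDiffOn ℝ 2 h U)
    (hconv : ConvexOn ℝ U h) {x : EuclideanSpace ℝ (Fin d)} (hx : x ∈ U)
    (v : EuclideanSpace ℝ (Fin d)) : 0 ≤ Hess h x v v := by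
  have hd1 : ∀ y ∈ U, DifferentiableAt ℝ h y := fun y hy =>
    (hreg.differentiableOn (by norm_num)).differentiableAt (hU.mem_nhds hy)
  have hd2 : DifferentiableAt ℝ (fderiv ℝ h) x :=
    ((hreg.fderiv_of_isOpen hU (m := 1) (by norm_num)).differentiableOn
      (by norm_num)).differentiableAt (hU.mem_nhds hx)
  let S : Set ℝ := (fun t : ℝ => x + t • v) ⁻¹' U
  have hS : IsOpen S := hU.preimage (by fun_prop)
  have h0 : (0 : ℝ) ∈ S := by simpa [S] using hx
  have hc : ConvexOn ℝ S (fun t : ℝ => h (x + t • v)) := by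
    have hline : ⇑(AffineMap.lineMap x (x + v) : ℝ →ᵃ[ℝ] EuclideanSpace ℝ (Fin d)) =
        fun t : ℝ => x + t • v := by
      ext1 t
      simp [AffineMap.lineMap_apply, add_comm]
    have := hconv.comp_affineMap (AffineMap.lineMap x (x + v) : ℝ →ᵃ[ℝ] _)
    rwa [hline] at this
  have hm : MonotoneOn (fun s : ℝ => fderiv ℝ h (x + s • v) v) S := by
    have := hc.monotoneOn_deriv (fun t ht => (hasDerivAt_line (hd1 _ ht)).differentiableAt)
    exact this.congr fun t ht => (hasDerivAt_line (hd1 _ ht)).deriv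
  have hD := hasDerivAt_fderiv_line (h := h) (x := x) (v := v) (t := 0) (by simpa using hd2)
  have key := hm.derivWithin_nonneg (x := 0)
  rw [derivWithin_of_isOpen hS h0, hD.deriv] at key
  simpa using key

/-- A positive semidefinite bilinear form is bounded by its trace. -/
theorem apply_self_le_norm_sq_mul_trace {d : ℕ}
    (B : EuclideanSpace ℝ (Fin d) →L[ℝ] EuclideanSpace ℝ (Fin d) →L[ℝ] ℝ)
    (hB : ∀ v, 0 ≤ B v v) (v : EuclideanSpace ℝ (Fin d)) :
    B v v ≤ ‖v‖ ^ 2 * ∑ i, B (EuclideanSpace.single i 1) (EuclideanSpace.single i 1) := by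
  set e : Fin d → EuclideanSpace ℝ (Fin d) := fun i => EuclideanSpace.single i 1 with he
  have hv : v = ∑ i, v i • e i := by
    ext j
    simp [he, Finset.sum_apply, Pi.single_apply]
  have hvv : B v v = ∑ i, ∑ j, v i * v j * B (e i) (e j) := by
    conv_lhs => rw [hv]
    simp only [map_sum, map_smul, sum_apply, smul_apply,
      smul_eq_mul, Finset.mul_sum]
    rw [Finset.sum_comm]
    refine Finset.sum_congr rfl fun i _ => Finset.sum_congr rfl fun j _ => by ring
  have hvv' : B v v = ∑ i, ∑ j, v i * v j * B (e j) (e i) := by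
    rw [hvv, Finset.sum_comm]
    refine Finset.sum_congr rfl fun i _ => Finset.sum_congr rfl fun j _ => by ring
  have hn : ‖v‖ ^ 2 * ∑ i, B (e i) (e i) = ∑ i, ∑ j, v i ^ 2 * B (e j) (e j) := by
    rw [EuclideanSpace.real_norm_sq_eq, Finset.sum_mul_sum]
  have hn' : ‖v‖ ^ 2 * ∑ i, B (e i) (e i) = ∑ i, ∑ j, v j ^ 2 * B (e i) (e i) := by
    rw [hn, Finset.sum_comm]
  have key : 0 ≤ ∑ i, ∑ j, B (v j • e i - v i • e j) (v j • e i - v i • e j) :=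
    Finset.sum_nonneg fun i _ => Finset.sum_nonneg fun j _ => hB _
  have : ∑ i, ∑ j, B (v j • e i - v i • e j) (v j • e i - v i • e j) =
      ∑ i, ∑ j, v j ^ 2 * B (e i) (e i) + ∑ i, ∑ j, v i ^ 2 * B (e j) (e j)
      - ∑ i, ∑ j, v i * v j * B (e i) (e j) - ∑ i, ∑ j, v i * v j * B (e j) (e i) := by
    simp only [← Finset.sum_add_distrib, ← Finset.sum_sub_distrib]
    refine Finset.sum_congr rfl fun i _ => Finset.sum_congr rfl fun j _ => ?_
    simp only [map_sub, map_smul, sub_apply, smul_apply,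
      smul_eq_mul]
    ring
  rw [this, ← hvv, ← hvv', ← hn, ← hn'] at key
  linarith

theorem hasDerivAt_sqrt_one_sub {t : ℝ} (ht : t < 1) :
    HasDerivAt (fun s : ℝ => √(1 - s)) (-(1 / (2 * √(1 - t)))) t := by
  have := ((hasDerivAt_id t).const_sub 1).sqrt (by simp; linarith)
  exact this.congr_deriv (by simp [neg_div])

theorem hasDerivAt_inv_sqrt_one_sub {t : ℝ} (ht : t < 1) :
    HasDerivAt (fun s : ℝ => (√(1 - s))⁻¹) (1 / (2 * ((1 - t) * √(1 - t)))) t := by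
  have hp : 0 < √(1 - t) := Real.sqrt_pos.2 (by linarith)
  refine ((hasDerivAt_sqrt_one_sub ht).inv hp.ne').congr_deriv ?_
  rw [Real.sq_sqrt (by linarith)]
  have : (0 : ℝ) < 1 - t := by linarith
  field_simp

theorem antitoneOn_Ico_of_hasDerivAt_nonpos {f f' : ℝ → ℝ}
    (hf : ∀ t ∈ Set.Ico (0 : ℝ) 1, HasDerivAt f (f' t) t)
    (hf' : ∀ t ∈ Set.Ico (0 : ℝ) 1, f' t ≤ 0) : AntitoneOn f (Set.Ico 0 1) :=
  antitoneOn_of_hasDerivWithinAt_nonpos (convex_Ico 0 1)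
    (fun t ht => (hf t ht).continuousAt.continuousWithinAt)
    (fun t ht => (hf t (interior_subset ht)).hasDerivWithinAt)
    (fun t ht => hf' t (interior_subset ht))

/-- A one-variable function with `0 ≤ φ'' ≤ K (1 - t) ^ (-3 / 2)` oscillates on `[t, 1)` by at most
a constant times `√(1 - t)`. -/
theorem abs_sub_le_of_second_deriv_bound {φ φ' φ'' : ℝ → ℝ} {K M : ℝ} (hK : 0 ≤ K)
    (h1 : ∀ t ∈ Set.Ico (0 : ℝ) 1, HasDerivAt φ (φ' t) t)
    (h2 : ∀ t ∈ Set.Ico (0 : ℝ) 1, HasDerivAt φ' (φ'' t) t)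
    (hpos : ∀ t ∈ Set.Ico (0 : ℝ) 1, 0 ≤ φ'' t)
    (hle : ∀ t ∈ Set.Ico (0 : ℝ) 1, (1 - t) * √(1 - t) * φ'' t ≤ K)
    (hM : |φ' 0| ≤ M) {s t : ℝ} (ht : 0 ≤ t) (hts : t ≤ s) (hs : s < 1) :
    |φ s - φ t| ≤ 2 * (M + 2 * K) * √(1 - t) := by
  obtain ⟨hM1, hM2⟩ := abs_le.1 hM
  have hM0 : 0 ≤ M := (abs_nonneg _).trans hM
  have h0 : (0 : ℝ) ∈ Set.Ico (0 : ℝ) 1 := by simp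
  have hsq : ∀ t ∈ Set.Ico (0 : ℝ) 1, 0 < √(1 - t) := fun t ht =>
    Real.sqrt_pos.2 (by linarith [ht.2])
  have hone : ∀ t ∈ Set.Ico (0 : ℝ) 1, 1 ≤ (√(1 - t))⁻¹ := fun t ht =>
    (one_le_inv₀ (hsq t ht)).2 (Real.sqrt_le_one.2 (by linarith [ht.1]))
  have hlow : ∀ t ∈ Set.Ico (0 : ℝ) 1, -M ≤ φ' t := by
    intro t ht
    have := antitoneOn_Ico_of_hasDerivAt_nonpos (fun t ht => (h2 t ht).neg)
      (fun t ht => by linarith [hpos t ht]) h0 ht ht.1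
    simp only [Pi.neg_apply] at this
    linarith
  have hup : ∀ t ∈ Set.Ico (0 : ℝ) 1, φ' t ≤ (M + 2 * K) * (√(1 - t))⁻¹ := by
    intro t ht
    have := antitoneOn_Ico_of_hasDerivAt_nonpos
      (fun t ht => (h2 t ht).sub ((hasDerivAt_inv_sqrt_one_sub ht.2).const_mul (2 * K)))
      (fun t ht => by
        have hp : 0 < (1 - t) * √(1 - t) := mul_pos (by linarith [ht.2]) (hsq t ht)
        have h3 : φ'' t ≤ K / ((1 - t) * √(1 - t)) := by
          rw [le_div_iff₀ hp]; linarith [hle t ht]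
        have h4 : 2 * K * (1 / (2 * ((1 - t) * √(1 - t)))) = K / ((1 - t) * √(1 - t)) := by
          field_simp
        linarith) h0 ht ht.1
    simp at this
    nlinarith [hone t ht]
  have habs : ∀ t ∈ Set.Ico (0 : ℝ) 1, |φ' t| ≤ (M + 2 * K) * (√(1 - t))⁻¹ := fun t ht =>
    abs_le.2 ⟨by nlinarith [hlow t ht, hone t ht], hup t ht⟩
  have hder : ∀ t ∈ Set.Ico (0 : ℝ) 1, HasDerivAt (fun s => 2 * (M + 2 * K) * √(1 - s))
      (-((M + 2 * K) * (√(1 - t))⁻¹)) t := fun t ht => by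
    refine ((hasDerivAt_sqrt_one_sub ht.2).const_mul (2 * (M + 2 * K))).congr_deriv ?_
    have := hsq t ht
    field_simp
  have htI : t ∈ Set.Ico (0 : ℝ) 1 := ⟨ht, by linarith⟩
  have hsI : s ∈ Set.Ico (0 : ℝ) 1 := ⟨by linarith, hs⟩
  have a1 := antitoneOn_Ico_of_hasDerivAt_nonpos (fun t ht => (h1 t ht).add (hder t ht))
    (fun t ht => by linarith [(abs_le.1 (habs t ht)).2]) htI hsI hts
  have a2 := antitoneOn_Ico_of_hasDerivAt_nonpos (fun t ht => (h1 t ht).neg.add (hder t ht))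
    (fun t ht => by linarith [(abs_le.1 (habs t ht)).1]) htI hsI hts
  simp only [Pi.add_apply, Pi.neg_apply] at a1 a2
  have : 0 ≤ 2 * (M + 2 * K) * √(1 - s) := by positivity
  exact abs_le.2 ⟨by linarith, by linarith⟩

/-- A bound on the mean curvature controls the second derivative of `h` along rays. -/
theorem hess_ray_le_of_mean_le {d : ℕ} (hd : d ≠ 0) {h : EuclideanSpace ℝ (Fin d) → ℝ}
    (hreg : ContDiffOn ℝ 2 h (Metric.ball 0 1)) (hconv : ConvexOn ℝ (Metric.ball 0 1) h)
    {v : EuclideanSpace ℝ (Fin d)} (hv : ‖v‖ ≤ 1) {t C : ℝ} (ht : t ∈ Set.Ico (0 : ℝ) 1)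
    (hC : Mean h (t • v) ≤ C) :
    (1 - t) * √(1 - t) * Hess h (t • v) v v ≤ d * C := by
  have hball : t • v ∈ Metric.ball (0 : EuclideanSpace ℝ (Fin d)) 1 := by
    rw [mem_ball_zero_iff, norm_smul, Real.norm_of_nonneg ht.1]
    nlinarith [ht.1, ht.2, norm_nonneg v]
  have hd2 : DifferentiableAt ℝ (fderiv ℝ h) (t • v) :=
    ((hreg.fderiv_of_isOpen Metric.isOpen_ball (m := 1) (by norm_num)).differentiableOn
      (by norm_num)).differentiableAt (Metric.isOpen_ball.mem_nhds hball)
  have hpos := hess_nonneg_of_convexOn Metric.isOpen_ball hreg hconv hball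
  have hvl : Hess h (t • v) v v ≤ ‖v‖ ^ 2 * lapl h (t • v) := by
    simp only [lapl, hess_eq_fderiv_fderiv hd2] at hpos ⊢
    exact apply_self_le_norm_sq_mul_trace _ hpos v
  have hl : 0 ≤ lapl h (t • v) := Finset.sum_nonneg fun i _ => hpos _
  have hv1 : ‖v‖ ^ 2 ≤ 1 := pow_le_one₀ (norm_nonneg v) hv
  have hvl' : Hess h (t • v) v v ≤ lapl h (t • v) := hvl.trans (mul_le_of_le_one_left hl hv1)
  have hxx : Hess h (t • v) (t • v) (t • v) = t ^ 2 * Hess h (t • v) v v := by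
    simp only [hess_eq_fderiv_fderiv hd2, map_smul, smul_apply, smul_eq_mul]
    ring
  have hH := hpos v
  have h1 : (1 - t) * Hess h (t • v) v v ≤ lapl h (t • v) - Hess h (t • v) (t • v) (t • v) := by
    rw [hxx]
    nlinarith [mul_nonneg (mul_nonneg ht.1 (sub_nonneg.2 ht.2.le)) hH]
  have h2 : √(1 - t) ≤ √(1 - ‖t • v‖ ^ 2) := by
    apply Real.sqrt_le_sqrt
    rw [norm_smul, mul_pow, Real.norm_of_nonneg ht.1]
    nlinarith [ht.1, ht.2, mul_le_of_le_one_right (sq_nonneg t) hv1]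
  have h3 : d * Mean h (t • v) =
      √(1 - ‖t • v‖ ^ 2) * (lapl h (t • v) - Hess h (t • v) (t • v) (t • v)) := by
    have : (d : ℝ) ≠ 0 := by exact_mod_cast hd
    rw [Mean]
    field_simp
  calc (1 - t) * √(1 - t) * Hess h (t • v) v v
      = √(1 - t) * ((1 - t) * Hess h (t • v) v v) := by ring
    _ ≤ √(1 - ‖t • v‖ ^ 2) * (lapl h (t • v) - Hess h (t • v) (t • v) (t • v)) :=
        mul_le_mul h2 h1 (mul_nonneg (by linarith [ht.2]) hH) (Real.sqrt_nonneg _)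
    _ = d * Mean h (t • v) := h3.symm
    _ ≤ d * C := by gcongr

/-- A function on the open unit ball that is uniformly Cauchy along rays near the boundary extends
continuously to the closed ball. -/
theorem exists_continuousOn_closedBall_extension {E : Type*} [NormedAddCommGroup E]
    [NormedSpace ℝ E] {h : E → ℝ} (hc : ContinuousOn h (Metric.ball 0 1)) {A : ℝ}
    (hA : ∀ v : E, ‖v‖ ≤ 1 → ∀ s t : ℝ, 0 ≤ t → t ≤ s → s < 1 →
      |h (s • v) - h (t • v)| ≤ A * √(1 - t)) :
    ∃ g : E → ℝ, ContinuousOn g (Metric.closedBall 0 1) ∧ ∀ x ∈ Metric.ball (0 : E) 1,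
      g x = h x := by
  let r : ℕ → ℝ := fun n => 1 - 1 / ((n : ℝ) + 1)
  have hr0 : ∀ n, 0 ≤ r n := fun n => by
    have : 1 / ((n : ℝ) + 1) ≤ 1 := by
      rw [div_le_one (by positivity)]; linarith [Nat.cast_nonneg (α := ℝ) n]
    simp only [r]; linarith
  have hr1 : ∀ n, r n < 1 := fun n => by
    have : 0 < 1 / ((n : ℝ) + 1) := by positivity
    simp only [r]; linarith
  have hrm : Monotone r := fun m n hmn => by
    have := Nat.one_div_le_one_div (α := ℝ) hmn
    simp only [r]; linarith
  have hrt : Filter.Tendsto r Filter.atTop (nhds 1) := by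
    simpa [r] using (tendsto_one_div_add_atTop_nhds_zero_nat (𝕜 := ℝ)).const_sub 1
  have hmem : ∀ n, ∀ x ∈ Metric.closedBall (0 : E) 1, r n • x ∈ Metric.ball (0 : E) 1 := by
    intro n x hx
    rw [mem_closedBall_zero_iff] at hx
    rw [mem_ball_zero_iff, norm_smul, Real.norm_of_nonneg (hr0 n)]
    nlinarith [hr0 n, hr1 n, norm_nonneg x]
  have hb : Filter.Tendsto (fun n => A * √(1 - r n)) Filter.atTop (nhds 0) := by
    have : Filter.Tendsto (fun n => A * √(1 - r n)) Filter.atTop (nhds (A * √(1 - 1))) :=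
      ((hrt.const_sub 1).sqrt).const_mul A
    simpa using this
  have hUC : UniformCauchySeqOn (fun n x => h (r n • x)) Filter.atTop
      (Metric.closedBall (0 : E) 1) := by
    rw [Metric.uniformCauchySeqOn_iff]
    intro ε hε
    obtain ⟨N, hN⟩ := Filter.eventually_atTop.1 (hb.eventually (gt_mem_nhds hε))
    refine ⟨N, fun m hm n hn x hx => ?_⟩
    rw [mem_closedBall_zero_iff] at hx
    rcases le_total m n with hmn | hmn
    · rw [dist_comm]
      exact (hA x hx _ _ (hr0 m) (hrm hmn) (hr1 n)).trans_lt (hN m hm)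
    · exact (hA x hx _ _ (hr0 n) (hrm hmn) (hr1 m)).trans_lt (hN n hn)
  have hlim : ∀ x ∈ Metric.closedBall (0 : E) 1,
      Filter.Tendsto (fun n => h (r n • x)) Filter.atTop
        (nhds (Filter.limUnder Filter.atTop fun n => h (r n • x))) :=
    fun x hx => (hUC.cauchySeq hx).tendsto_limUnder
  refine ⟨fun x => Filter.limUnder Filter.atTop fun n => h (r n • x), ?_, fun x hx => ?_⟩
  · refine (hUC.tendstoUniformlyOn_of_tendsto hlim).continuousOn
      (Filter.Eventually.frequently (Filter.Eventually.of_forall fun n => ?_))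
    exact hc.comp (by fun_prop) (hmem n)
  · have h1 : Filter.Tendsto (fun n => r n • x) Filter.atTop (nhds x) := by
      simpa using hrt.smul_const x
    exact tendsto_nhds_unique (hlim x (Metric.ball_subset_closedBall hx))
      ((hc.continuousAt (Metric.isOpen_ball.mem_nhds hx)).tendsto.comp h1)

/-- A `C²` convex function on the open unit ball whose mean curvature is
bounded above extends continuously to the closed ball. -/
theorem continuous_extension_of_bounded_mean_curvature (d : ℕ)
    (h : EuclideanSpace ℝ (Fin d) → ℝ)
    (hreg : ContDiffOn ℝ 2 h (Metric.ball 0 1))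
    (hconv : ConvexOn ℝ (Metric.ball 0 1) h)
    (hbdd : ∃ C : ℝ, ∀ x ∈ Metric.ball (0 : EuclideanSpace ℝ (Fin d)) 1, Mean h x ≤ C) :
    ∃ g : EuclideanSpace ℝ (Fin d) → ℝ,
      ContinuousOn g (Metric.closedBall 0 1) ∧
      ∀ x ∈ Metric.ball (0 : EuclideanSpace ℝ (Fin d)) 1, g x = h x := by
  obtain ⟨C, hC⟩ := hbdd
  rcases eq_or_ne d 0 with rfl | hd
  · exact ⟨h, (continuous_of_discreteTopology).continuousOn, fun _ _ => rfl⟩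
  have hd1 : DifferentiableOn ℝ h (Metric.ball 0 1) := hreg.differentiableOn (by norm_num)
  have hd2 : DifferentiableOn ℝ (fderiv ℝ h) (Metric.ball 0 1) :=
    (hreg.fderiv_of_isOpen Metric.isOpen_ball (m := 1) (by norm_num)).differentiableOn
      (by norm_num)
  refine exists_continuousOn_closedBall_extension hreg.continuousOn
    (A := 2 * (‖fderiv ℝ h 0‖ + 2 * (d * max C 0))) fun v hv s t ht hts hs => ?_
  have hball : ∀ t ∈ Set.Ico (0 : ℝ) 1,
      Metric.ball (0 : EuclideanSpace ℝ (Fin d)) 1 ∈ nhds (t • v) := fun t ht => by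
    refine Metric.isOpen_ball.mem_nhds ?_
    rw [mem_ball_zero_iff, norm_smul, Real.norm_of_nonneg ht.1]
    nlinarith [ht.1, ht.2, norm_nonneg v]
  refine abs_sub_le_of_second_deriv_bound (φ := fun t => h (t • v))
    (φ' := fun t => fderiv ℝ h (t • v) v) (φ'' := fun t => Hess h (t • v) v v)
    (by positivity) (fun t ht => ?_) (fun t ht => ?_)
    (fun t ht => hess_nonneg_of_convexOn Metric.isOpen_ball hreg hconv
      (mem_of_mem_nhds (hball t ht)) v)
    (fun t ht => hess_ray_le_of_mean_le hd hreg hconv hv ht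
      ((hC _ (mem_of_mem_nhds (hball t ht))).trans (le_max_left _ _)))
    ?_ ht hts hs
  · simpa using hasDerivAt_line (h := h) (x := 0) (v := v) (t := t)
      (by simpa using hd1.differentiableAt (hball t ht))
  · simpa using hasDerivAt_fderiv_line (h := h) (x := 0) (v := v) (t := t)
      (by simpa using hd2.differentiableAt (hball t ht))
  · simpa using (fderiv ℝ h 0).le_of_opNorm_le_of_le le_rfl hv
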